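/- Let k and l be even nonnegative integers and let n be a positive integer. If 2^n exactly divides k - l (i.e. 2^n divides k - l but 2^(n+1) does not divide k - l), then 2^n exactly divides E_k - E_l. -/

import Mathlib

/-- The Euler numbers: `E 0 = 1` and
`E n = -∑_{0 ≤ k < n, n - k even} (n choose k) * E k` for `n ≥ 1`. -/
def eulerNumber : ℕ → ℤ
  | 0 => 1
  | n + 1 =>
    -∑ k ∈ (Finset.range (n + 1)).attach,
      if Even (n + 1 - k.1) then ((n + 1).choose k.1 : ℤ) * eulerNumber k.1 else 0
  decreasing_by exact Finset.mem_range.mp k.2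

/-- The Euler polynomial `E_n(x) = ∑_{k=0}^n (n choose k) (E_k / 2^k) (x - 1/2)^(n-k)`. -/
noncomputable def eulerPoly (n : ℕ) : Polynomial ℚ :=
  ∑ k ∈ Finset.range (n + 1),
    Polynomial.C ((n.choose k : ℚ) * (eulerNumber k : ℚ) / 2 ^ k) *
      (Polynomial.X - Polynomial.C (1 / 2)) ^ (n - k)

open Polynomial Finset

/-- The umbral functional on `ℚ[X]` sending `X ^ n` to the Euler number `E n`. -/
noncomputable def eulerFunctional : ℚ[X] →ₗ[ℚ] ℚ :=
  Polynomial.lsum fun n => LinearMap.lsmul ℚ ℚ (eulerNumber n : ℚ)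

lemma eulerFunctional_C_mul_X_pow (c : ℚ) (n : ℕ) :
    eulerFunctional (C c * X ^ n) = c * eulerNumber n := by
  rw [C_mul_X_pow_eq_monomial, eulerFunctional, Polynomial.lsum_apply,
    Polynomial.sum_monomial_index _ _ (by simp)]
  simp [mul_comm]

lemma eulerFunctional_X_pow (n : ℕ) : eulerFunctional (X ^ n) = eulerNumber n := by
  simpa using eulerFunctional_C_mul_X_pow 1 n

lemma eulerNumber_zero : eulerNumber 0 = 1 := by rw [eulerNumber]

lemma sum_choose_mul_eulerNumber {n : ℕ} (hn : n ≠ 0) :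
    ∑ k ∈ range (n + 1), (if Even (n - k) then (n.choose k : ℤ) * eulerNumber k else 0) = 0 := by
  obtain ⟨n, rfl⟩ := Nat.exists_eq_succ_of_ne_zero hn
  rw [sum_range_succ, Nat.succ_eq_add_one, eulerNumber,
    sum_attach (range (n + 1)) fun k =>
      if Even (n + 1 - k) then ((n + 1).choose k : ℤ) * eulerNumber k else 0]
  simp

lemma eulerFunctional_add_one_pow_add_sub_one_pow {n : ℕ} (hn : n ≠ 0) :
    eulerFunctional ((X + 1) ^ n + (X - 1) ^ n) = 0 := by
  have expand : ((X : ℚ[X]) + 1) ^ n + (X - 1) ^ n =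
      ∑ k ∈ range (n + 1), C (if Even (n - k) then 2 * (n.choose k : ℚ) else 0) * X ^ k := by
    rw [sub_eq_add_neg, add_pow, add_pow, ← sum_add_distrib]
    refine sum_congr rfl fun k _ => ?_
    split_ifs with h
    · rw [h.neg_one_pow]
      simp only [one_pow, map_mul, map_natCast, map_ofNat]
      ring
    · rw [(Nat.not_even_iff_odd.mp h).neg_one_pow]
      simp
  rw [expand, map_sum]
  simp only [eulerFunctional_C_mul_X_pow]
  have h := congrArg (fun z : ℤ => 2 * (z : ℚ)) (sum_choose_mul_eulerNumber hn)
  simp only [Int.cast_sum, mul_sum, Int.cast_zero, mul_zero] at h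
  refine (sum_congr rfl fun k _ => ?_).trans h
  split_ifs
  · push_cast
    ring
  · simp

/-- Integer polynomials `T n` with `2 ^ (n + 1) T n ((x² - 1) / 2) = (x + 1)^(2n) + (x - 1)^(2n)`. -/
noncomputable def evenPartPoly : ℕ → ℤ[X]
  | 0 => 1
  | 1 => X + 1
  | n + 2 => 2 * ((X + 1) * evenPartPoly (n + 1)) - X ^ 2 * evenPartPoly n

/-- The polynomial `(X² - 1) / 2`. -/
noncomputable def halfSqSubOne : ℚ[X] := C (1 / 2) * (X ^ 2 - 1)

lemma two_mul_halfSqSubOne : 2 * halfSqSubOne = X ^ 2 - 1 := by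
  rw [halfSqSubOne, ← mul_assoc, ← C_ofNat, ← C_mul]
  norm_num

lemma aeval_evenPartPoly (n : ℕ) :
    2 ^ (n + 1) * aeval halfSqSubOne (evenPartPoly n) =
      (X + 1) ^ (2 * n) + (X - 1) ^ (2 * n) := by
  have h := two_mul_halfSqSubOne
  induction n using Nat.twoStepInduction with
  | zero => norm_num [evenPartPoly]
  | one =>
    simp only [evenPartPoly, map_add, aeval_X, map_one]
    linear_combination 2 * h
  | more n ih1 ih2 =>
    simp only [evenPartPoly, map_add, map_sub, map_mul, map_pow, aeval_X, map_one, map_ofNat]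
    generalize aeval halfSqSubOne (evenPartPoly n) = p at *
    generalize aeval halfSqSubOne (evenPartPoly (n + 1)) = q at *
    generalize halfSqSubOne = v at *
    have hv : (2 * v) ^ 2 = (X ^ 2 - 1) ^ 2 := by rw [h]
    linear_combination 2 ^ (n + 3) * q * h - 2 ^ (n + 1) * p * hv +
      (2 * X ^ 2 + 2) * ih2 - (X ^ 2 - 1) ^ 2 * ih1

lemma natDegree_evenPartPoly_le (n : ℕ) : (evenPartPoly n).natDegree ≤ n := by
  induction n using Nat.twoStepInduction with
  | zero => simp [evenPartPoly]
  | one => simp only [evenPartPoly]; compute_degree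
  | more n ih1 ih2 =>
    have h1 : ((2 : ℤ[X]) * ((X + 1) * evenPartPoly (n + 1))).natDegree ≤ 0 + (1 + (n + 1)) :=
      natDegree_mul_le_of_le (by compute_degree) (natDegree_mul_le_of_le (by compute_degree) ih2)
    have h2 : ((X : ℤ[X]) ^ 2 * evenPartPoly n).natDegree ≤ 2 + n :=
      natDegree_mul_le_of_le (by compute_degree) ih1
    rw [evenPartPoly]
    exact (natDegree_sub_le _ _).trans (max_le (by omega) (by omega))

lemma coeff_evenPartPoly_self (n : ℕ) : (evenPartPoly n).coeff n = 1 := by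
  induction n using Nat.twoStepInduction with
  | zero => simp [evenPartPoly]
  | one => simp [evenPartPoly, coeff_one]
  | more n ih1 ih2 =>
    have h : (evenPartPoly (n + 1)).coeff (n + 2) = 0 :=
      coeff_eq_zero_of_natDegree_lt ((natDegree_evenPartPoly_le _).trans_lt (by omega))
    rw [evenPartPoly, coeff_sub, coeff_X_pow_mul, coeff_ofNat_mul, add_mul, coeff_add, one_mul,
      coeff_X_mul, ih1, ih2, h]
    norm_num

lemma two_dvd_coeff_evenPartPoly {n j : ℕ} (h : j + 2 ≤ n) : (2 : ℤ) ∣ (evenPartPoly n).coeff j := by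
  induction n using Nat.twoStepInduction generalizing j with
  | zero => omega
  | one => omega
  | more n ih1 _ =>
    rw [evenPartPoly, coeff_sub, coeff_ofNat_mul, coeff_X_pow_mul']
    refine dvd_sub (dvd_mul_right _ _) ?_
    split_ifs
    · exact ih1 (by omega)
    · exact dvd_zero _

lemma two_dvd_coeff_one_evenPartPoly_two : (2 : ℤ) ∣ (evenPartPoly 2).coeff 1 := by
  rw [evenPartPoly, coeff_sub, coeff_ofNat_mul, coeff_X_pow_mul']
  exact dvd_sub (dvd_mul_right _ _) (by simp)

/-- The umbral value of `((x² - 1) / 2) ^ n` at the Euler numbers. -/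
noncomputable def eulerMoment (n : ℕ) : ℚ := eulerFunctional (halfSqSubOne ^ n)

lemma eulerFunctional_aeval {p : ℤ[X]} {n : ℕ} (h : p.natDegree < n) :
    eulerFunctional (aeval halfSqSubOne p) = ∑ j ∈ range n, (p.coeff j : ℚ) * eulerMoment j := by
  rw [aeval_eq_sum_range' h, map_sum]
  refine sum_congr rfl fun j _ => ?_
  rw [map_zsmul, zsmul_eq_mul, eulerMoment]

lemma eulerMoment_eq_neg_sum {n : ℕ} (hn : n ≠ 0) :
    eulerMoment n = -∑ j ∈ range n, ((evenPartPoly n).coeff j : ℚ) * eulerMoment j := by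
  have h := eulerFunctional_add_one_pow_add_sub_one_pow (n := 2 * n) (by omega)
  rw [← aeval_evenPartPoly, ← C_ofNat, ← C_pow, ← smul_eq_C_mul, map_smul, smul_eq_mul,
    eulerFunctional_aeval (Nat.lt_succ_of_le (natDegree_evenPartPoly_le n)), sum_range_succ,
    coeff_evenPartPoly_self] at h
  have h' := (mul_eq_zero.mp h).resolve_left (by positivity)
  push_cast at h'
  linarith

lemma eulerMoment_zero : eulerMoment 0 = 1 := by
  simpa [eulerMoment, eulerNumber_zero] using eulerFunctional_X_pow 0

lemma eulerMoment_one : eulerMoment 1 = -1 := by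
  rw [eulerMoment_eq_neg_sum one_ne_zero]
  simp [evenPartPoly, eulerMoment_zero]

lemma exists_int_eq_eulerMoment (n : ℕ) :
    ∃ z : ℤ, eulerMoment n = z ∧ (2 ≤ n → 2 ∣ z) := by
  induction n using Nat.strong_induction_on with
  | _ n ih =>
    rcases Nat.eq_zero_or_pos n with rfl | hn
    · exact ⟨1, by simp [eulerMoment_zero], by omega⟩
    choose! z hz hz2 using ih
    refine ⟨-∑ j ∈ range n, (evenPartPoly n).coeff j * z j, ?_, fun h => ?_⟩
    · rw [eulerMoment_eq_neg_sum hn.ne']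
      push_cast
      congr 1
      exact sum_congr rfl fun j hj => by rw [hz j (mem_range.mp hj)]
    · refine (dvd_sum fun j hj => ?_).neg_right
      have hj := mem_range.mp hj
      by_cases hjn : j + 2 ≤ n
      · exact (two_dvd_coeff_evenPartPoly hjn).mul_right _
      by_cases hj2 : 2 ≤ j
      · exact (hz2 j hj hj2).mul_left _
      obtain ⟨rfl, rfl⟩ : j = 1 ∧ n = 2 := by omega
      exact two_dvd_coeff_one_evenPartPoly_two.mul_right _

lemma eulerNumber_two_mul (a : ℕ) :
    (eulerNumber (2 * a) : ℚ) = eulerFunctional (aeval halfSqSubOne ((1 + 2 * X : ℤ[X]) ^ a)) := by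
  rw [← eulerFunctional_X_pow, pow_mul]
  have h : aeval halfSqSubOne ((1 + 2 * X : ℤ[X]) ^ a) = (X ^ 2) ^ a := by
    simp only [map_pow, map_add, map_mul, map_one, map_ofNat, aeval_X, two_mul_halfSqSubOne]
    ring
  rw [h]

lemma exists_eulerFunctional_aeval_eq (g : ℤ[X]) :
    ∃ z : ℤ, eulerFunctional (aeval halfSqSubOne g) = (g.coeff 0 - g.coeff 1 + 2 * z : ℤ) := by
  choose ν hν hν2 using fun j => exists_int_eq_eulerMoment (j + 2)
  choose μ hμ using fun j => hν2 j (by omega)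
  refine ⟨∑ j ∈ range g.natDegree, g.coeff (j + 2) * μ j, ?_⟩
  rw [eulerFunctional_aeval (show g.natDegree < g.natDegree + 2 by omega), sum_range_succ',
    sum_range_succ', eulerMoment_zero, zero_add, eulerMoment_one]
  push_cast
  have h : ∑ j ∈ range g.natDegree, (g.coeff (j + 1 + 1) : ℚ) * eulerMoment (j + 1 + 1) =
      2 * ∑ j ∈ range g.natDegree, (g.coeff (j + 2) : ℚ) * μ j := by
    rw [mul_sum]
    refine sum_congr rfl fun j _ => ?_
    rw [hν, hμ]
    push_cast
    ring
  rw [h]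
  ring

lemma two_pow_dvd_one_add_two_mul_X_pow_sub {a b r : ℕ} (h : (2 : ℤ) ^ r ∣ (a : ℤ) - b) :
    (2 : ℤ[X]) ^ (r + 1) ∣ (1 + 2 * X) ^ a - (1 + 2 * X) ^ b := by
  wlog hab : b ≤ a generalizing a b
  · exact (dvd_sub_comm).mp (this ((dvd_sub_comm).mp h) (by omega))
  obtain ⟨d, rfl⟩ := Nat.exists_eq_add_of_le hab
  obtain ⟨c, rfl⟩ : 2 ^ r ∣ d := by
    have h' : (2 : ℤ) ^ r ∣ d := by simpa using h
    exact_mod_cast h'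
  have h1 : (2 : ℤ[X]) ^ (r + 1) ∣ (1 + 2 * X) ^ 2 ^ r - 1 ^ 2 ^ r := by
    exact_mod_cast dvd_sub_pow_of_dvd_sub (p := 2) (a := (1 + 2 * X : ℤ[X])) (b := 1)
      (by simp) r
  have h2 := h1.trans (sub_dvd_pow_sub_pow _ _ c)
  simp only [one_pow, ← pow_mul] at h2
  have h3 := h2.mul_left ((1 + 2 * X) ^ b)
  rwa [mul_sub_one, ← pow_add] at h3

lemma coeff_one_one_add_two_mul_X_pow (a : ℕ) :
    ((1 + 2 * X : ℤ[X]) ^ a).coeff 1 = 2 * a := by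
  have h := coeff_derivative ((1 + 2 * X : ℤ[X]) ^ a) 0
  rw [coeff_zero_eq_eval_zero] at h
  simp [derivative_pow] at h
  linarith

theorem stmt_3 (k l : ℕ) (hk : Even k) (hl : Even l) (n : ℕ) (hn : 0 < n)
    (h1 : (2 : ℤ) ^ n ∣ (k : ℤ) - l) (h2 : ¬ (2 : ℤ) ^ (n + 1) ∣ (k : ℤ) - l) :
    (2 : ℤ) ^ n ∣ eulerNumber k - eulerNumber l ∧
      ¬ (2 : ℤ) ^ (n + 1) ∣ eulerNumber k - eulerNumber l := by
  obtain ⟨a, rfl⟩ := hk.two_dvd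
  obtain ⟨b, rfl⟩ := hl.two_dvd
  obtain ⟨r, rfl⟩ := Nat.exists_eq_add_of_le' hn
  push_cast at h1 h2
  rw [← mul_sub] at h1 h2
  have hr : (2 : ℤ) ^ r ∣ (a : ℤ) - b := by
    rw [pow_succ'] at h1
    exact (mul_dvd_mul_iff_left two_ne_zero).mp h1
  obtain ⟨g, hg⟩ := two_pow_dvd_one_add_two_mul_X_pow_sub hr
  rw [show (2 : ℤ[X]) ^ (r + 1) = C (2 ^ (r + 1)) by simp] at hg
  have hg0 : g.coeff 0 = 0 := by
    have h := congrArg (coeff · 0) hg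
    simpa [coeff_zero_eq_eval_zero] using h
  have hg1 : 2 * ((a : ℤ) - b) = 2 ^ (r + 1) * g.coeff 1 := by
    have h := congrArg (coeff · 1) hg
    simp only [coeff_sub, coeff_C_mul, coeff_one_one_add_two_mul_X_pow] at h
    linarith
  obtain ⟨z, hz⟩ := exists_eulerFunctional_aeval_eq g
  have key : eulerNumber (2 * a) - eulerNumber (2 * b) = 2 ^ (r + 1) * (-g.coeff 1 + 2 * z) := by
    have h : (eulerNumber (2 * a) - eulerNumber (2 * b) : ℚ) =
        2 ^ (r + 1) * (-g.coeff 1 + 2 * z) := by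
      rw [eulerNumber_two_mul, eulerNumber_two_mul, ← map_sub, ← map_sub, hg,
        ← smul_eq_C_mul, map_zsmul, map_zsmul, hz, hg0]
      simp [mul_add]
    exact_mod_cast h
  have hpow : (2 : ℤ) ^ (r + 1) ≠ 0 := by positivity
  rw [key]
  refine ⟨dvd_mul_right _ _, fun h => h2 ?_⟩
  rw [pow_succ, mul_dvd_mul_iff_left hpow] at h
  rw [hg1, pow_succ, mul_dvd_mul_iff_left hpow]
  omega
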